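/- Let N ≥ 1 and k > 0. There exists a constant C > 0 depending only on N and k such that for all x ∈ ℝ^N and all t > 0, ∫_{ℝ^N} G(x−y, t) |y|^{−N} (log(e+|y|^{−1}))^{−k−1} χ₁(|y|) dy ≤ C |x|^{−N} (log(e+|x|^{−1}))^{−k}. -/

import Mathlib

open MeasureTheory Real Set ENNReal

noncomputable def heatKernel (N : ℕ) (x : EuclideanSpace ℝ (Fin N)) (t : ℝ) : ℝ :=
  (4 * Real.pi * t) ^ (-(N : ℝ) / 2) * Real.exp (-‖x‖ ^ 2 / (4 * t))

/-- The logarithmic weight `log (e + 1/s)`. -/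
noncomputable def logWeight (s : ℝ) : ℝ := Real.log (Real.exp 1 + s⁻¹)

/-- The derivative on `(0, ∞)` of `s ↦ logWeight s ^ (-k)`. -/
noncomputable def logWeightDeriv (k s : ℝ) : ℝ :=
  k * logWeight s ^ (-k - 1) * (s * (Real.exp 1 * s + 1))⁻¹

lemma one_le_logWeight {s : ℝ} (hs : 0 ≤ s) : 1 ≤ logWeight s := by
  have h : 0 ≤ s⁻¹ := inv_nonneg.2 hs
  rw [logWeight, Real.le_log_iff_exp_le (by positivity)]
  linarith

lemma logWeightDeriv_nonneg {k s : ℝ} (hk : 0 < k) (hs : 0 < s) : 0 ≤ logWeightDeriv k s := by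
  have h := one_le_logWeight hs.le
  unfold logWeightDeriv
  positivity

lemma hasDerivAt_logWeight_rpow {k s : ℝ} (hs : 0 < s) :
    HasDerivAt (fun u => logWeight u ^ (-k)) (logWeightDeriv k s) s := by
  have h1 : HasDerivAt (fun u : ℝ => Real.exp 1 + u⁻¹) (-(s ^ 2)⁻¹) s :=
    (hasDerivAt_inv hs.ne').const_add _
  have h2 := h1.log (by positivity)
  have hL := one_le_logWeight hs.le
  have h3 := h2.rpow_const (p := -k) (Or.inl (by change logWeight s ≠ 0; linarith))
  refine h3.congr_deriv ?_
  change _ * _ * logWeight s ^ (-k - 1) = _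
  unfold logWeightDeriv
  field_simp

lemma tendsto_logWeight_rpow {k : ℝ} (hk : 0 < k) :
    Filter.Tendsto (fun u => logWeight u ^ (-k)) (nhdsWithin 0 (Ioi 0)) (nhds 0) := by
  refine (tendsto_rpow_neg_atTop hk).comp ?_
  exact Real.tendsto_log_atTop.comp
    (Filter.tendsto_atTop_add_const_left _ _ tendsto_inv_nhdsGT_zero)

lemma integrableOn_logWeightDeriv {k ρ : ℝ} (hk : 0 < k) :
    IntegrableOn (logWeightDeriv k) (Ioc 0 ρ) := by
  have hder : ∀ x ∈ Ioo 0 ρ, HasDerivAt (Function.update (fun u => logWeight u ^ (-k)) 0 0)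
      (logWeightDeriv k x) x := fun x hx => by
    refine (hasDerivAt_logWeight_rpow hx.1).congr_of_eventuallyEq ?_
    filter_upwards [isOpen_ne.mem_nhds hx.1.ne'] with u hu
    exact Function.update_of_ne hu _ _
  refine intervalIntegral.integrableOn_deriv_of_nonneg ?_ hder
    (fun x hx => logWeightDeriv_nonneg hk hx.1)
  intro x hx
  rcases hx.1.eq_or_lt with rfl | h0
  · rw [continuousWithinAt_update_same]
    refine (tendsto_logWeight_rpow hk).mono_left (nhdsWithin_mono _ ?_)
    rintro u ⟨hu, hu0⟩
    exact lt_of_le_of_ne hu.1 (Ne.symm hu0)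
  · refine ContinuousAt.continuousWithinAt ?_
    refine (hasDerivAt_logWeight_rpow (k := k) h0).continuousAt.congr ?_
    filter_upwards [isOpen_ne.mem_nhds h0.ne'] with u hu
    exact (Function.update_of_ne hu (0 : ℝ) fun u => logWeight u ^ (-k)).symm

lemma integral_logWeightDeriv {k ρ : ℝ} (hk : 0 < k) (hρ : 0 < ρ) :
    ∫ s in Ioc 0 ρ, logWeightDeriv k s = logWeight ρ ^ (-k) := by
  rw [← intervalIntegral.integral_of_le hρ.le,
    intervalIntegral.integral_eq_sub_of_hasDerivAt_of_tendsto hρ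
      (fun x hx => hasDerivAt_logWeight_rpow (k := k) hx.1)
      ((intervalIntegrable_iff_integrableOn_Ioc_of_le hρ.le).2 (integrableOn_logWeightDeriv hk))
      (tendsto_logWeight_rpow hk)
      ((hasDerivAt_logWeight_rpow hρ).continuousAt.tendsto.mono_left nhdsWithin_le_nhds),
    sub_zero]

/-- The radial profile whose integral over `ℝ^N` is a multiple of `logWeight ρ ^ (-k)`. -/
noncomputable def radialProfile (N : ℕ) (k ρ : ℝ) : ℝ → ℝ :=
  (Ioc 0 ρ).indicator fun s => (s ^ (N - 1))⁻¹ * logWeightDeriv k s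

lemma radialProfile_nonneg {N : ℕ} {k ρ : ℝ} (hk : 0 < k) (s : ℝ) : 0 ≤ radialProfile N k ρ s := by
  refine indicator_nonneg (fun u hu => ?_) s
  have h := logWeightDeriv_nonneg hk hu.1
  have h0 := hu.1
  positivity

lemma pow_smul_radialProfile (N : ℕ) (k ρ s : ℝ) :
    s ^ (N - 1) • radialProfile N k ρ s = (Ioc 0 ρ).indicator (logWeightDeriv k) s := by
  by_cases hs : s ∈ Ioc 0 ρ
  · have h0 : s ^ (N - 1) ≠ 0 := pow_ne_zero _ hs.1.ne'
    simp [radialProfile, hs, h0]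
  · simp [radialProfile, hs]

lemma integrable_radialProfile_norm {N : ℕ} (hN : 1 ≤ N) {k ρ : ℝ} (hk : 0 < k) :
    Integrable fun y : EuclideanSpace ℝ (Fin N) => radialProfile N k ρ ‖y‖ := by
  have : Nonempty (Fin N) := ⟨⟨0, hN⟩⟩
  rw [integrable_fun_norm_addHaar]
  simp only [finrank_euclideanSpace_fin, pow_smul_radialProfile]
  exact ((integrable_indicator_iff measurableSet_Ioc).2
    (integrableOn_logWeightDeriv hk)).integrableOn

lemma integral_radialProfile_norm {N : ℕ} (hN : 1 ≤ N) {k ρ : ℝ} (hk : 0 < k) (hρ : 0 < ρ) :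
    ∫ y : EuclideanSpace ℝ (Fin N), radialProfile N k ρ ‖y‖ =
      N * volume.real (Metric.ball (0 : EuclideanSpace ℝ (Fin N)) 1) * logWeight ρ ^ (-k) := by
  have : Nonempty (Fin N) := ⟨⟨0, hN⟩⟩
  rw [integral_fun_norm_addHaar]
  simp only [finrank_euclideanSpace_fin, pow_smul_radialProfile]
  rw [setIntegral_indicator measurableSet_Ioc, inter_eq_right.2 Ioc_subset_Ioi_self,
    integral_logWeightDeriv hk hρ, nsmul_eq_mul, smul_eq_mul, mul_assoc]

lemma rpow_mul_logWeight_le_radialProfile {N : ℕ} (hN : 1 ≤ N) {k ρ s : ℝ} (hk : 0 < k)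
    (hs : 0 < s) (hsρ : s ≤ ρ) (hs1 : s ≤ 1) :
    s ^ (-(N : ℝ)) * logWeight s ^ (-k - 1) ≤ (Real.exp 1 + 1) / k * radialProfile N k ρ s := by
  have hL := one_le_logWeight hs.le
  have hpow : s ^ N = s ^ (N - 1) * s := by rw [← pow_succ, Nat.sub_add_cancel hN]
  rw [radialProfile, indicator_of_mem (show s ∈ Ioc 0 ρ from ⟨hs, hsρ⟩), logWeightDeriv,
    Real.rpow_neg hs.le, Real.rpow_natCast, hpow]
  have he : Real.exp 1 * s + 1 ≤ Real.exp 1 + 1 := by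
    nlinarith [Real.exp_pos 1]
  have h1 : 1 ≤ (Real.exp 1 + 1) * (Real.exp 1 * s + 1)⁻¹ := by
    rw [← div_eq_mul_inv, le_div_iff₀ (by positivity)]
    linarith
  calc (s ^ (N - 1) * s)⁻¹ * logWeight s ^ (-k - 1)
      ≤ ((s ^ (N - 1) * s)⁻¹ * logWeight s ^ (-k - 1)) *
          ((Real.exp 1 + 1) * (Real.exp 1 * s + 1)⁻¹) :=
        le_mul_of_one_le_right (by positivity) h1
    _ = _ := by field_simp

lemma logWeight_le_mul {r s ε : ℝ} (hr : 0 < r) (hs : 0 < s) (hrs : r ≤ 2 * s) (hε : 0 < ε) :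
    logWeight r ≤ (1 + 1 / ε) * (2 * s / r) ^ ε * logWeight s := by
  set q := 2 * s / r with hq
  have hq1 : 1 ≤ q := by rwa [hq, le_div_iff₀ hr, one_mul]
  have hsq : r⁻¹ ≤ q * s⁻¹ := by
    rw [hq]; field_simp; norm_num
  have hL := one_le_logWeight hs.le
  have hlog : Real.log q ≤ q ^ ε / ε := Real.log_le_rpow_div (by linarith) hε
  have hqε : 1 ≤ q ^ ε := Real.one_le_rpow hq1 hε.le
  have h0 : 0 ≤ Real.log q := Real.log_nonneg hq1
  have hsum : logWeight r ≤ Real.log q + logWeight s := by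
    unfold logWeight
    rw [← Real.log_mul (by positivity) (by positivity)]
    apply Real.log_le_log (by positivity)
    nlinarith [Real.exp_pos 1]
  calc logWeight r ≤ Real.log q + logWeight s := hsum
    _ ≤ Real.log q * logWeight s + q ^ ε * logWeight s := by nlinarith
    _ ≤ q ^ ε / ε * logWeight s + q ^ ε * logWeight s := by gcongr
    _ = _ := by ring

/-- Up to a constant, `s ↦ s ^ (-n) * logWeight s ^ (-k)` is decreasing. -/
lemma rpow_mul_logWeight_le_of_le_two_mul {n k r s : ℝ} (hn : 0 < n) (hk : 0 < k) (hr : 0 < r)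
    (hs : 0 < s) (hrs : r ≤ 2 * s) :
    s ^ (-n) * logWeight s ^ (-k - 1) ≤
      (1 + k / n) ^ k * 2 ^ n * (r ^ (-n) * logWeight r ^ (-k)) := by
  have hL := one_le_logWeight hs.le
  have hLr := one_le_logWeight hr.le
  have h := Real.rpow_le_rpow (by linarith)
    (logWeight_le_mul hr hs hrs (div_pos hn hk)) hk.le
  rw [Real.mul_rpow (by positivity) (by positivity), Real.mul_rpow (by positivity) (by positivity),
    ← Real.rpow_mul (by positivity), div_mul_cancel₀ _ hk.ne', one_div_div,
    Real.div_rpow (by positivity) hr.le, Real.mul_rpow (by norm_num) hs.le] at h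
  have h1 : logWeight s ^ (-k - 1) ≤ logWeight s ^ (-k) :=
    Real.rpow_le_rpow_of_exponent_le hL (by linarith)
  refine (mul_le_mul_of_nonneg_left h1 (by positivity)).trans ?_
  rw [Real.rpow_neg hs.le, Real.rpow_neg hr.le, Real.rpow_neg (by linarith),
    Real.rpow_neg (by linarith)]
  have p1 : 0 < s ^ n := by positivity
  have p2 : 0 < r ^ n := by positivity
  have p3 : 0 < logWeight s ^ k := by positivity
  have p4 : 0 < logWeight r ^ k := by positivity
  rw [← mul_inv, ← mul_inv, ← div_eq_mul_inv, inv_eq_one_div, div_le_div_iff₀ (by positivity)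
    (by positivity)]
  calc 1 * (r ^ n * logWeight r ^ k)
      ≤ r ^ n * ((1 + k / n) ^ k * (2 ^ n * s ^ n / r ^ n) * logWeight s ^ k) := by
        rw [one_mul]; gcongr
    _ = _ := by field_simp

lemma heatKernel_nonneg {N : ℕ} (x : EuclideanSpace ℝ (Fin N)) {t : ℝ} (ht : 0 < t) :
    0 ≤ heatKernel N x t := by
  unfold heatKernel
  positivity

lemma integrable_heatKernel (N : ℕ) {t : ℝ} (ht : 0 < t) :
    Integrable fun y : EuclideanSpace ℝ (Fin N) => heatKernel N y t := by
  unfold heatKernel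
  refine Integrable.const_mul ?_ _
  have hb : 0 < (4 * t)⁻¹ := by positivity
  refine Integrable.of_integral_ne_zero ?_
  have h := GaussianFourier.integral_rexp_neg_mul_sq_norm (V := EuclideanSpace ℝ (Fin N)) hb
  have he : ∀ v : EuclideanSpace ℝ (Fin N), -‖v‖ ^ 2 / (4 * t) = -(4 * t)⁻¹ * ‖v‖ ^ 2 :=
    fun v => by ring
  simp only [he, h]
  positivity

lemma integral_heatKernel (N : ℕ) {t : ℝ} (ht : 0 < t) :
    ∫ y : EuclideanSpace ℝ (Fin N), heatKernel N y t = 1 := by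
  have hb : 0 < (4 * t)⁻¹ := by positivity
  have h := GaussianFourier.integral_rexp_neg_mul_sq_norm (V := EuclideanSpace ℝ (Fin N)) hb
  have he : ∀ v : EuclideanSpace ℝ (Fin N), -‖v‖ ^ 2 / (4 * t) = -(4 * t)⁻¹ * ‖v‖ ^ 2 :=
    fun v => by ring
  have hp : Real.pi / (4 * t)⁻¹ = 4 * Real.pi * t := by field_simp
  unfold heatKernel
  simp only [he, integral_const_mul, h, finrank_euclideanSpace_fin, hp]
  rw [← Real.rpow_add (by positivity), neg_div, neg_add_cancel, Real.rpow_zero]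

lemma rpow_le_rpow_mul_exp {a u : ℝ} (ha : 0 < a) (hu : 0 ≤ u) :
    u ^ a ≤ a ^ a * Real.exp u := by
  have h : u ≤ a * Real.exp (u / a) := by
    have := Real.add_one_le_exp (u / a)
    calc u = a * (u / a) := by field_simp
      _ ≤ _ := by gcongr; linarith
  calc u ^ a ≤ (a * Real.exp (u / a)) ^ a := Real.rpow_le_rpow hu h ha.le
    _ = _ := by
      rw [Real.mul_rpow ha.le (Real.exp_pos _).le, ← Real.exp_mul, div_mul_cancel₀ _ ha.ne']

lemma heatKernel_le_of_le_two_mul {N : ℕ} (hN : 1 ≤ N) {r t : ℝ} (hr : 0 < r) (ht : 0 < t)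
    {z : EuclideanSpace ℝ (Fin N)} (hz : r ≤ 2 * ‖z‖) :
    heatKernel N z t ≤
      ((N : ℝ) / 2) ^ ((N : ℝ) / 2) * (Real.pi / 4) ^ (-(N : ℝ) / 2) * r ^ (-(N : ℝ)) := by
  have hN0 : (0 : ℝ) < N := by exact_mod_cast hN
  set u := r ^ 2 / (16 * t) with hu
  have hu0 : 0 < u := by positivity
  have ha : 0 < (N : ℝ) / 2 := by positivity
  have h4 : 4 * Real.pi * t = Real.pi / 4 * r ^ 2 * u⁻¹ := by
    rw [hu]; field_simp; ring
  have hexp : Real.exp (-‖z‖ ^ 2 / (4 * t)) ≤ Real.exp (-u) := by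
    apply Real.exp_le_exp.2
    rw [hu, neg_div, neg_le_neg_iff, div_le_div_iff₀ (by positivity) (by positivity)]
    have : r ^ 2 ≤ (2 * ‖z‖) ^ 2 := by gcongr
    nlinarith
  have hr2 : (r ^ 2) ^ (-(N : ℝ) / 2) = r ^ (-(N : ℝ)) := by
    rw [← Real.rpow_natCast, ← Real.rpow_mul hr.le]
    congr 1
    push_cast
    ring
  have hui : u⁻¹ ^ (-(N : ℝ) / 2) = u ^ ((N : ℝ) / 2) := by
    rw [Real.inv_rpow hu0.le, ← Real.rpow_neg hu0.le, neg_div, neg_neg]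
  have hmain : u ^ ((N : ℝ) / 2) * Real.exp (-u) ≤ ((N : ℝ) / 2) ^ ((N : ℝ) / 2) := by
    rw [Real.exp_neg, ← div_eq_mul_inv, div_le_iff₀ (Real.exp_pos u)]
    exact rpow_le_rpow_mul_exp ha hu0.le
  calc heatKernel N z t
      ≤ (4 * Real.pi * t) ^ (-(N : ℝ) / 2) * Real.exp (-u) := by unfold heatKernel; gcongr
    _ = (Real.pi / 4) ^ (-(N : ℝ) / 2) * r ^ (-(N : ℝ)) *
          (u ^ ((N : ℝ) / 2) * Real.exp (-u)) := by
        rw [h4, Real.mul_rpow (by positivity) (by positivity),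
          Real.mul_rpow (by positivity) (by positivity), hr2, hui]
        ring
    _ ≤ (Real.pi / 4) ^ (-(N : ℝ) / 2) * r ^ (-(N : ℝ)) * ((N : ℝ) / 2) ^ ((N : ℝ) / 2) := by
        gcongr
    _ = _ := by ring

theorem statement12 (N : ℕ) (hN : 1 ≤ N) (k : ℝ) (hk : 0 < k) :
    ∃ C : ℝ, 0 < C ∧
      ∀ (x : EuclideanSpace ℝ (Fin N)) (t : ℝ), 0 < t →
        ∫⁻ y, ENNReal.ofReal (heatKernel N (x - y) t) * (‖y‖₊ : ℝ≥0∞) ^ (-(N : ℝ)) *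
            ENNReal.ofReal (Real.log (Real.exp 1 + ‖y‖⁻¹) ^ (-k - 1) *
              Set.indicator (Set.Icc (0 : ℝ) 1) (fun _ => (1 : ℝ)) ‖y‖)
          ≤ ENNReal.ofReal C * (‖x‖₊ : ℝ≥0∞) ^ (-(N : ℝ)) *
              ENNReal.ofReal (Real.log (Real.exp 1 + ‖x‖⁻¹) ^ (-k)) := by
  have : Nonempty (Fin N) := ⟨⟨0, hN⟩⟩
  have hN0 : (0 : ℝ) < N := by exact_mod_cast hN
  set c₁ : ℝ := ((N : ℝ) / 2) ^ ((N : ℝ) / 2) * (Real.pi / 4) ^ (-(N : ℝ) / 2) with hc₁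
  set c₂ : ℝ := (1 + k / N) ^ k * 2 ^ (N : ℝ) with hc₂
  set v : ℝ := volume.real (Metric.ball (0 : EuclideanSpace ℝ (Fin N)) 1)
  have hv : 0 ≤ v := measureReal_nonneg
  have hc₁0 : 0 < c₁ := by positivity
  have hc₂0 : 0 < c₂ := by positivity
  refine ⟨c₁ * ((Real.exp 1 + 1) / k) * (N * v) + c₂, by positivity, fun x t ht => ?_⟩
  have hcoe : ∀ y : EuclideanSpace ℝ (Fin N), y ≠ 0 →
      (‖y‖₊ : ℝ≥0∞) ^ (-(N : ℝ)) = ENNReal.ofReal (‖y‖ ^ (-(N : ℝ))) := fun y hy => by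
    rw [← ENNReal.ofReal_rpow_of_pos (norm_pos_iff.2 hy), ← enorm_eq_nnnorm, ofReal_norm]
  rcases eq_or_ne x 0 with rfl | hx
  · have htop : (‖(0 : EuclideanSpace ℝ (Fin N))‖₊ : ℝ≥0∞) ^ (-(N : ℝ)) = ⊤ := by simp [hN0]
    rw [htop, ENNReal.mul_top (by rw [Ne, ENNReal.ofReal_eq_zero, not_le]; positivity)]
    simp
  set r := ‖x‖ with hr
  have hr0 : 0 < r := norm_pos_iff.2 hx
  have hLr := one_le_logWeight hr0.le
  set A : ℝ := c₁ * r ^ (-(N : ℝ)) * ((Real.exp 1 + 1) / k) with hA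
  set B : ℝ := c₂ * (r ^ (-(N : ℝ)) * logWeight r ^ (-k)) with hB
  have hA0 : 0 ≤ A := by positivity
  have hB0 : 0 ≤ B := by positivity
  have hpt : ∀ y : EuclideanSpace ℝ (Fin N), y ≠ 0 →
      ENNReal.ofReal (heatKernel N (x - y) t) * (‖y‖₊ : ℝ≥0∞) ^ (-(N : ℝ)) *
            ENNReal.ofReal (Real.log (Real.exp 1 + ‖y‖⁻¹) ^ (-k - 1) *
              Set.indicator (Set.Icc (0 : ℝ) 1) (fun _ => (1 : ℝ)) ‖y‖) ≤
        ENNReal.ofReal (A * radialProfile N k r ‖y‖ + B * heatKernel N (x - y) t) := fun y hy => by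
    have hy0 : 0 < ‖y‖ := norm_pos_iff.2 hy
    have hL := one_le_logWeight hy0.le
    have hG := heatKernel_nonneg (x - y) ht
    have hφ := radialProfile_nonneg (N := N) (ρ := r) hk ‖y‖
    rw [hcoe y hy, ← ENNReal.ofReal_mul hG, ← ENNReal.ofReal_mul (by positivity)]
    apply ENNReal.ofReal_le_ofReal
    change heatKernel N (x - y) t * ‖y‖ ^ (-(N : ℝ)) * (logWeight ‖y‖ ^ (-k - 1) * _) ≤ _
    by_cases hy1 : ‖y‖ ≤ 1
    · rw [indicator_of_mem (show ‖y‖ ∈ Icc (0 : ℝ) 1 from ⟨hy0.le, hy1⟩), mul_one, mul_assoc]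
      by_cases hry : r ≤ 2 * ‖y‖
      · calc _ ≤ heatKernel N (x - y) t * B := by
              gcongr
              exact rpow_mul_logWeight_le_of_le_two_mul hN0 hk hr0 hy0 hry
          _ ≤ _ := by nlinarith [mul_nonneg hA0 hφ]
      · have hz : r ≤ 2 * ‖x - y‖ := by
          have := norm_sub_norm_le x y
          linarith
        calc _ ≤ (c₁ * r ^ (-(N : ℝ))) * ((Real.exp 1 + 1) / k * radialProfile N k r ‖y‖) := by
              exact mul_le_mul (heatKernel_le_of_le_two_mul hN hr0 ht hz)
                (rpow_mul_logWeight_le_radialProfile hN hk hy0 (by linarith) hy1)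
                (by positivity) (by positivity)
          _ = A * radialProfile N k r ‖y‖ := by rw [hA]; ring
          _ ≤ _ := le_add_of_nonneg_right (by positivity)
    · rw [indicator_of_notMem (fun h => hy1 h.2)]
      simp only [mul_zero]
      positivity
  have hint₁ := (integrable_radialProfile_norm (ρ := r) hN hk).const_mul A
  have hint₂ : Integrable fun y => B * heatKernel N (x - y) t := ((integrable_heatKernel N ht).comp_sub_left x).const_mul B
  calc _ ≤ ∫⁻ y, ENNReal.ofReal (A * radialProfile N k r ‖y‖ + B * heatKernel N (x - y) t) := by
        refine lintegral_mono_ae ?_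
        filter_upwards [compl_mem_ae_iff.2 (measure_singleton (0 : EuclideanSpace ℝ (Fin N)))]
          with y hy
        exact hpt y hy
    _ = ENNReal.ofReal (A * (N * v * logWeight r ^ (-k)) + B) := by
        rw [← ofReal_integral_eq_lintegral_ofReal
            (f := fun y => A * radialProfile N k r ‖y‖ + B * heatKernel N (x - y) t)
            (hint₁.add hint₂), integral_add hint₁ hint₂,
          integral_const_mul, integral_const_mul, integral_radialProfile_norm hN hk hr0,
          integral_sub_left_eq_self (fun z => heatKernel N z t), integral_heatKernel N ht, mul_one]
        exact Filter.Eventually.of_forall fun y => add_nonneg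
          (mul_nonneg hA0 (radialProfile_nonneg hk _)) (mul_nonneg hB0 (heatKernel_nonneg _ ht))
    _ = _ := by
        rw [hcoe x hx, ← ENNReal.ofReal_mul (by positivity), ← ENNReal.ofReal_mul (by positivity)]
        congr 1
        change _ = _ * logWeight r ^ (-k)
        rw [hA, hB]
        ring
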